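/- In the sparse regime, the covariance test is asymptotically powerless: if ε_n = n^{-β} with β ∈ (1/2,1) fixed and (ρ_n) is any sequence in [0,1], and (X₁,Y₁),…,(Xₙ,Yₙ) are i.i.d. from P_{ε_n,ρ_n}, then T_n/√n, with T_n := Σ_{i=1}^n X_i Y_i, converges in distribution to the standard normal — the same limiting distribution as when the observations are i.i.d. from N(0,Σ_0). Consequently, for every sequence of thresholds (a_n), the sum of the type I and type II error probabilities of the test rejecting when T_n ≥ a_n has liminf at least 1. -/

import Mathlib

open MeasureTheory ProbabilityTheory Real Filter Topology

noncomputable section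

/-- The standard normal distribution on ℝ. -/
def stdGauss : Measure ℝ := gaussianReal 0 1

/-- Two independent standard normals. -/
def stdGauss2 : Measure (ℝ × ℝ) := stdGauss.prod stdGauss

/-- `N(0, Σ_ρ)`: the centered bivariate normal with unit marginal variances and
correlation `ρ`, i.e. the law of `(Z₁, ρ Z₁ + √(1-ρ²) Z₂)` for independent standard
normal `Z₁, Z₂`. -/
def biNormal (ρ : ℝ) : Measure (ℝ × ℝ) :=
  stdGauss2.map fun z => (z.1, ρ * z.1 + Real.sqrt (1 - ρ ^ 2) * z.2)

/-- The contamination mixture `P_{ε,ρ} = (1-ε) N(0,Σ₀) + ε N(0,Σ_ρ)`. -/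
def mixture (ε ρ : ℝ) : Measure (ℝ × ℝ) :=
  ENNReal.ofReal (1 - ε) • biNormal 0 + ENNReal.ofReal ε • biNormal ρ

/-- The `n`-fold product (i.i.d.) measure. -/
def iid (n : ℕ) (μ : Measure (ℝ × ℝ)) : Measure (Fin n → ℝ × ℝ) :=
  Measure.pi fun _ => μ
/-- The standard normal distribution function. -/
def Phi (t : ℝ) : ℝ := (stdGauss (Set.Iic t)).toReal

/-- The normalized covariance statistic `Tₙ / √n`. -/
def covStat (n : ℕ) (x : Fin n → ℝ × ℝ) : ℝ := (∑ i, (x i).1 * (x i).2) / √n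

lemma measurable_covStat (n : ℕ) : Measurable (covStat n) := by
  unfold covStat
  fun_prop

instance : IsProbabilityMeasure stdGauss := by
  unfold stdGauss
  infer_instance

instance : NullSingletonClass stdGauss := by
  unfold stdGauss
  exact nullSingletonClass_gaussianReal one_ne_zero

instance : IsProbabilityMeasure stdGauss2 := by
  unfold stdGauss2
  infer_instance

instance (ρ : ℝ) : IsProbabilityMeasure (biNormal ρ) := by
  unfold biNormal
  exact Measure.isProbabilityMeasure_map (by fun_prop)

lemma isProbabilityMeasure_mixture {ε : ℝ} (hε : ε ∈ Set.Icc (0 : ℝ) 1) (ρ : ℝ) :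
    IsProbabilityMeasure (mixture ε ρ) := by
  constructor
  simp only [mixture, Measure.add_apply, Measure.smul_apply, measure_univ, smul_eq_mul, mul_one]
  rw [← ENNReal.ofReal_add (by linarith [hε.2]) hε.1]
  simp

lemma mixture_zero (ρ : ℝ) : mixture 0 ρ = biNormal 0 := by
  simp [mixture]

lemma biNormal_zero : biNormal 0 = stdGauss2 := by
  simp [biNormal]

instance (n : ℕ) (μ : Measure (ℝ × ℝ)) [IsProbabilityMeasure μ] :
    IsProbabilityMeasure (iid n μ) := by
  unfold iid
  infer_instance

lemma integral_id_stdGauss : ∫ x, x ∂stdGauss = 0 := by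
  simp [stdGauss]

lemma memLp_id_stdGauss : MemLp (fun x : ℝ => x) 2 stdGauss :=
  memLp_id_gaussianReal 2

lemma integral_sq_stdGauss : ∫ x, x ^ 2 ∂stdGauss = 1 := by
  have h := variance_of_integral_eq_zero (μ := stdGauss) (X := fun x : ℝ => x)
    (by fun_prop) integral_id_stdGauss
  rw [← h]
  simp [stdGauss]

lemma integrable_sq_stdGauss : Integrable (fun x : ℝ => x ^ 2) stdGauss :=
  memLp_id_stdGauss.integrable_sq

lemma charFun_map_covStat (n : ℕ) (μ : Measure (ℝ × ℝ)) [IsProbabilityMeasure μ] (t : ℝ) :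
    charFun ((iid n μ).map (covStat n)) t
      = charFun (μ.map fun z => z.1 * z.2) ((√n)⁻¹ * t) ^ n := by
  rw [charFun_apply_real, charFun_apply_real,
    integral_map (measurable_covStat n).aemeasurable (by fun_prop),
    integral_map (by fun_prop) (by fun_prop)]
  have h := integral_fintype_prod_eq_pow (ι := Fin n) (μ := μ)
    fun z : ℝ × ℝ => Complex.exp (((√n)⁻¹ * t : ℝ) * (z.1 * z.2 : ℝ) * Complex.I)
  rw [Fintype.card_fin] at h
  rw [← h, iid]
  congr 1 with x
  rw [← Complex.exp_sum, ← Finset.sum_mul, ← Finset.mul_sum, covStat]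
  push_cast
  congr 1
  ring

lemma norm_charFun_map_sub_one_le {Ω : Type*} [MeasurableSpace Ω] {μ : Measure Ω}
    [IsProbabilityMeasure μ] {f : Ω → ℝ} (hf : Measurable f) (hfi : Integrable f μ) (t : ℝ) :
    ‖charFun (μ.map f) t - 1‖ ≤ |t| * ∫ ω, |f ω| ∂μ := by
  rw [charFun_apply_real, integral_map hf.aemeasurable (by fun_prop)]
  have hint : Integrable (fun ω => Complex.exp (t * f ω * Complex.I)) μ := by
    refine Integrable.of_bound (by fun_prop) 1 (ae_of_all _ fun ω => ?_)
    rw [← Complex.ofReal_mul, Complex.norm_exp_ofReal_mul_I]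
  have h1 : ∫ ω, Complex.exp (t * f ω * Complex.I) ∂μ - 1
      = ∫ ω, (Complex.exp (t * f ω * Complex.I) - 1) ∂μ := by
    rw [integral_sub hint (integrable_const _)]
    simp
  rw [h1, ← integral_const_mul]
  refine norm_integral_le_of_norm_le (hfi.abs.const_mul _) (ae_of_all _ fun ω => ?_)
  have := norm_exp_I_mul_ofReal_sub_one_le (x := t * f ω)
  rwa [mul_comm, Complex.ofReal_mul, Real.norm_eq_abs, abs_mul] at this

lemma integrable_two_mul_sq_add_sq :
    Integrable (fun z : ℝ × ℝ => 2 * (z.1 ^ 2 + z.2 ^ 2)) stdGauss2 :=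
  ((integrable_sq_stdGauss.comp_fst _).add (integrable_sq_stdGauss.comp_snd _)).const_mul 2

lemma integral_two_mul_sq_add_sq :
    ∫ z : ℝ × ℝ, 2 * (z.1 ^ 2 + z.2 ^ 2) ∂stdGauss2 = 4 := by
  rw [stdGauss2, integral_const_mul, integral_add (integrable_sq_stdGauss.comp_fst _)
    (integrable_sq_stdGauss.comp_snd _),
    integral_fun_fst (fun x : ℝ => x ^ 2), integral_fun_snd (fun x : ℝ => x ^ 2),
    integral_sq_stdGauss]
  norm_num

lemma abs_mul_correlated_le {ρ : ℝ} (hρ : ρ ∈ Set.Icc (0 : ℝ) 1) (z : ℝ × ℝ) :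
    |z.1 * (ρ * z.1 + √(1 - ρ ^ 2) * z.2)| ≤ 2 * (z.1 ^ 2 + z.2 ^ 2) := by
  have hs0 : 0 ≤ √(1 - ρ ^ 2) := Real.sqrt_nonneg _
  have hs1 : √(1 - ρ ^ 2) ≤ 1 := Real.sqrt_le_one.2 (by nlinarith [hρ.1])
  rw [abs_le]
  generalize √(1 - ρ ^ 2) = s at *
  obtain ⟨h0, h1⟩ := hρ
  constructor <;>
  nlinarith [mul_nonneg h0 (sq_nonneg z.1), mul_nonneg (sub_nonneg.2 h1) (sq_nonneg z.1),
    mul_nonneg hs0 (sq_nonneg (z.1 + z.2)), mul_nonneg hs0 (sq_nonneg (z.1 - z.2)),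
    mul_nonneg (sub_nonneg.2 hs1) (add_nonneg (sq_nonneg z.1) (sq_nonneg z.2)),
    sq_nonneg z.1, sq_nonneg z.2]

lemma integrable_mul_biNormal {ρ : ℝ} (hρ : ρ ∈ Set.Icc (0 : ℝ) 1) :
    Integrable (fun z : ℝ × ℝ => z.1 * z.2) (biNormal ρ) := by
  rw [biNormal, integrable_map_measure (by fun_prop) (by fun_prop)]
  exact integrable_two_mul_sq_add_sq.mono' (by fun_prop)
    (ae_of_all _ fun z => abs_mul_correlated_le hρ z)

lemma integral_abs_mul_biNormal_le {ρ : ℝ} (hρ : ρ ∈ Set.Icc (0 : ℝ) 1) :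
    ∫ z, |z.1 * z.2| ∂(biNormal ρ) ≤ 4 := by
  rw [biNormal, integral_map (by fun_prop) (by fun_prop), ← integral_two_mul_sq_add_sq]
  exact integral_mono_of_nonneg (ae_of_all _ fun _ => abs_nonneg _)
    integrable_two_mul_sq_add_sq (ae_of_all _ fun z => abs_mul_correlated_le hρ z)

lemma norm_charFun_map_mul_biNormal_sub_one_le {ρ : ℝ} (hρ : ρ ∈ Set.Icc (0 : ℝ) 1) (t : ℝ) :
    ‖charFun ((biNormal ρ).map fun z => z.1 * z.2) t - 1‖ ≤ 4 * |t| := by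
  refine (norm_charFun_map_sub_one_le (by fun_prop) (integrable_mul_biNormal hρ) t).trans ?_
  rw [mul_comm]
  exact mul_le_mul_of_nonneg_right (integral_abs_mul_biNormal_le hρ) (abs_nonneg t)

lemma charFun_map_mul_mixture {ε : ℝ} (hε : ε ∈ Set.Icc (0 : ℝ) 1) (ρ t : ℝ) :
    charFun ((mixture ε ρ).map fun z => z.1 * z.2) t
      = (1 - ε) * charFun ((biNormal 0).map fun z => z.1 * z.2) t
        + ε * charFun ((biNormal ρ).map fun z => z.1 * z.2) t := by
  have hint (r : ℝ) : Integrable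
      (fun z : ℝ × ℝ => Complex.exp (t * (z.1 * z.2 : ℝ) * Complex.I)) (biNormal r) := by
    refine Integrable.of_bound (by fun_prop) 1 (ae_of_all _ fun z => ?_)
    rw [← Complex.ofReal_mul, Complex.norm_exp_ofReal_mul_I]
  simp_rw [charFun_apply_real]
  rw [integral_map (by fun_prop) (by fun_prop), integral_map (by fun_prop) (by fun_prop),
    integral_map (by fun_prop) (by fun_prop), mixture,
    integral_add_measure ((hint 0).smul_measure (by simp)) ((hint ρ).smul_measure (by simp)),
    integral_smul_measure, integral_smul_measure, ENNReal.toReal_ofReal hε.1,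
    ENNReal.toReal_ofReal (by linarith [hε.2])]
  simp

lemma norm_charFun_mixture_sub_le {ε ρ : ℝ} (hε : ε ∈ Set.Icc (0 : ℝ) 1)
    (hρ : ρ ∈ Set.Icc (0 : ℝ) 1) (t : ℝ) :
    ‖charFun ((mixture ε ρ).map fun z => z.1 * z.2) t
      - charFun ((biNormal 0).map fun z => z.1 * z.2) t‖ ≤ 8 * ε * |t| := by
  have h0 := norm_charFun_map_mul_biNormal_sub_one_le ⟨le_rfl, zero_le_one⟩ t
  have h1 := norm_charFun_map_mul_biNormal_sub_one_le hρ t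
  rw [charFun_map_mul_mixture hε]
  generalize charFun ((biNormal 0).map fun z => z.1 * z.2) t = a at *
  generalize charFun ((biNormal ρ).map fun z => z.1 * z.2) t = b at *
  have : (1 - ε) * a + ε * b - a = ε * ((b - 1) - (a - 1)) := by ring
  rw [this, norm_mul, Complex.norm_real, Real.norm_of_nonneg hε.1]
  have h2 := norm_sub_le (b - 1) (a - 1)
  nlinarith [mul_le_mul_of_nonneg_left (h2.trans (add_le_add h1 h0)) hε.1]

lemma norm_pow_sub_pow_le_of_norm_le_one {R : Type*} [NormedCommRing R] [NormOneClass R]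
    {a b : R} (ha : ‖a‖ ≤ 1) (hb : ‖b‖ ≤ 1) (n : ℕ) :
    ‖a ^ n - b ^ n‖ ≤ n * ‖a - b‖ := by
  induction n with
  | zero => simp
  | succ n ih =>
    have : a ^ (n + 1) - b ^ (n + 1) = a ^ n * (a - b) + (a ^ n - b ^ n) * b := by ring
    rw [this]
    have h1 : ‖a ^ n * (a - b)‖ ≤ ‖a - b‖ := (norm_mul_le _ _).trans <|
      mul_le_of_le_one_left (norm_nonneg _)
        ((norm_pow_le a n).trans (pow_le_one₀ (norm_nonneg _) ha))
    have h2 : ‖(a ^ n - b ^ n) * b‖ ≤ ‖a ^ n - b ^ n‖ := (norm_mul_le _ _).trans <|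
      mul_le_of_le_one_right (norm_nonneg _) hb
    push_cast
    linarith [norm_add_le (a ^ n * (a - b)) ((a ^ n - b ^ n) * b)]

lemma tendsto_charFun_covStat_biNormal_zero (t : ℝ) :
    Tendsto (fun n : ℕ => charFun ((biNormal 0).map fun z => z.1 * z.2) ((√n)⁻¹ * t) ^ n) atTop
      (𝓝 (charFun stdGauss t)) := by
  have h0 : ∫ z : ℝ × ℝ, z.1 * z.2 ∂(biNormal 0) = 0 := by
    rw [biNormal_zero, stdGauss2, integral_prod_mul (fun x : ℝ => x) fun x : ℝ => x,
      integral_id_stdGauss, mul_zero]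
  have h1 : ∫ z : ℝ × ℝ, (z.1 * z.2) ^ 2 ∂(biNormal 0) = 1 := by
    simp_rw [mul_pow]
    rw [biNormal_zero, stdGauss2, integral_prod_mul (fun x : ℝ => x ^ 2) fun x : ℝ => x ^ 2,
      integral_sq_stdGauss, mul_one]
  have h := tendsto_charFun_inv_sqrt_mul_pow (P := biNormal 0)
    (X := fun z : ℝ × ℝ => z.1 * z.2) (by fun_prop) h0 (by simpa using h1) t
  simpa [stdGauss, charFun_gaussianReal, neg_div] using h

lemma tendsto_charFun_covStat_mixture {ε ρ : ℕ → ℝ} (hε : ∀ n, ε n ∈ Set.Icc (0 : ℝ) 1)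
    (hρ : ∀ n, ρ n ∈ Set.Icc (0 : ℝ) 1)
    (hlim : Tendsto (fun n : ℕ => √n * ε n) atTop (𝓝 0)) (t : ℝ) :
    Tendsto (fun n : ℕ => charFun ((iid n (mixture (ε n) (ρ n))).map (covStat n)) t) atTop
      (𝓝 (charFun stdGauss t)) := by
  have := fun n => isProbabilityMeasure_mixture (hε n) (ρ n)
  simp_rw [charFun_map_covStat]
  refine tendsto_of_tendsto_of_dist (tendsto_charFun_covStat_biNormal_zero t) ?_
  have hb : Tendsto (fun n : ℕ => 8 * |t| * (√n * ε n)) atTop (𝓝 0) := by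
    simpa using hlim.const_mul (8 * |t|)
  refine squeeze_zero (fun _ => dist_nonneg) (fun n => ?_) hb
  rw [dist_comm, dist_eq_norm]
  have := Measure.isProbabilityMeasure_map (μ := mixture (ε n) (ρ n))
    (f := fun z => z.1 * z.2) (by fun_prop)
  have := Measure.isProbabilityMeasure_map (μ := biNormal 0)
    (f := fun z => z.1 * z.2) (by fun_prop)
  refine (norm_pow_sub_pow_le_of_norm_le_one (norm_charFun_le_one _) (norm_charFun_le_one _)
    n).trans ?_
  refine (mul_le_mul_of_nonneg_left (norm_charFun_mixture_sub_le (hε n) (hρ n) _)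
    n.cast_nonneg).trans_eq ?_
  rw [abs_mul, abs_of_nonneg (by positivity : 0 ≤ (√(n : ℝ))⁻¹)]
  have hn : (n : ℝ) * (√n)⁻¹ = √n := by rw [← div_eq_mul_inv, Real.div_sqrt]
  linear_combination (8 * ε n * |t|) * hn

lemma tendsto_real_covStat_mixture {ε ρ : ℕ → ℝ} (hε : ∀ n, ε n ∈ Set.Icc (0 : ℝ) 1)
    (hρ : ∀ n, ρ n ∈ Set.Icc (0 : ℝ) 1)
    (hlim : Tendsto (fun n : ℕ => √n * ε n) atTop (𝓝 0)) {s : Set ℝ} (hs : MeasurableSet s)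
    (hfr : stdGauss (frontier s) = 0) :
    Tendsto (fun n => (iid n (mixture (ε n) (ρ n))).real {x | covStat n x ∈ s}) atTop
      (𝓝 (stdGauss.real s)) := by
  have := fun n => isProbabilityMeasure_mixture (hε n) (ρ n)
  let μ (n : ℕ) : ProbabilityMeasure ℝ := ⟨(iid n (mixture (ε n) (ρ n))).map (covStat n),
    Measure.isProbabilityMeasure_map (measurable_covStat n).aemeasurable⟩
  have hμ : Tendsto μ atTop (𝓝 ⟨stdGauss, inferInstance⟩) :=
    ProbabilityMeasure.tendsto_of_tendsto_charFun (tendsto_charFun_covStat_mixture hε hρ hlim)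
  have h := (ENNReal.tendsto_toReal (measure_ne_top stdGauss s)).comp
    (ProbabilityMeasure.tendsto_measure_of_null_frontier_of_tendsto' hμ hfr)
  refine h.congr fun n => ?_
  simp only [Function.comp_apply, μ, ProbabilityMeasure.coe_mk, Measure.real]
  rw [Measure.map_apply (measurable_covStat n) hs]
  rfl

/-- **Pólya's theorem** along a moving sequence of points: if monotone `[0,1]`-valued functions
converge pointwise to a monotone function attaining every value in `(0,1)`, the convergence
persists at arbitrary moving points. -/
lemma tendsto_sub_of_monotone_of_tendsto {F : ℕ → ℝ → ℝ} {G : ℝ → ℝ}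
    (hF : ∀ n, Monotone (F n)) (hF01 : ∀ n x, F n x ∈ Set.Icc (0 : ℝ) 1) (hG : Monotone G)
    (hG01 : ∀ x, G x ∈ Set.Icc (0 : ℝ) 1) (hsurj : Set.Ioo (0 : ℝ) 1 ⊆ Set.range G)
    (hlim : ∀ x, Tendsto (fun n => F n x) atTop (𝓝 (G x))) (b : ℕ → ℝ) :
    Tendsto (fun n => F n (b n) - G (b n)) atTop (𝓝 0) := by
  rw [tendsto_iff_ultrafilter]
  intro U hU
  obtain ⟨p, hp, hGp⟩ := isCompact_Icc.ultrafilter_le_nhds (U.map fun n => G (b n))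
    (le_principal_iff.2 (Ultrafilter.mem_map.2 (univ_mem' fun n => hG01 (b n))))
  have hGp : Tendsto (fun n => G (b n)) U (𝓝 p) := hGp
  suffices hFp : Tendsto (fun n => F n (b n)) U (𝓝 p) by simpa using hFp.sub hGp
  refine tendsto_order.2 ⟨fun q hq => ?_, fun q hq => ?_⟩
  · by_cases hq0 : q < 0
    · exact Eventually.of_forall fun n => hq0.trans_le (hF01 n _).1
    obtain ⟨r, hqr, hrp⟩ := exists_between hq
    obtain ⟨c, rfl⟩ := hsurj ⟨(not_lt.1 hq0).trans_lt hqr, hrp.trans_le hp.2⟩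
    filter_upwards [hU ((hlim c).eventually_const_lt hqr), hGp.eventually_const_lt hrp]
      with n h1 h2
    exact h1.trans_le (hF n (hG.reflect_lt h2).le)
  · by_cases hq1 : 1 < q
    · exact Eventually.of_forall fun n => (hF01 n _).2.trans_lt hq1
    obtain ⟨r, hpr, hrq⟩ := exists_between hq
    obtain ⟨c, rfl⟩ := hsurj ⟨hp.1.trans_lt hpr, hrq.trans_le (not_lt.1 hq1)⟩
    filter_upwards [hU ((hlim c).eventually_lt_const hrq), hGp.eventually_lt_const hpr]
      with n h1 h2
    exact (hF n (hG.reflect_lt h2).le).trans_lt h1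

lemma continuous_cdf_of_nullSingletonClass (μ : Measure ℝ) [IsProbabilityMeasure μ]
    [NullSingletonClass μ] :
    Continuous (cdf μ) := by
  refine continuous_iff_continuousAt.2 fun x => ?_
  rw [(monotone_cdf μ).continuousAt_iff_leftLim_eq_rightLim, (cdf μ).rightLim_eq]
  have h := (cdf μ).measure_singleton x
  rw [measure_cdf, measure_singleton] at h
  exact le_antisymm ((monotone_cdf μ).leftLim_le le_rfl)
    (sub_nonpos.1 (ENNReal.ofReal_eq_zero.1 h.symm))

lemma Ioo_subset_range_cdf (μ : Measure ℝ) [IsProbabilityMeasure μ] [NullSingletonClass μ] :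
    Set.Ioo (0 : ℝ) 1 ⊆ Set.range (cdf μ) := fun _ hq =>
  mem_range_of_exists_le_of_exists_ge (continuous_cdf_of_nullSingletonClass μ)
    ((tendsto_cdf_atBot μ).eventually_le_const hq.1).exists
    ((tendsto_cdf_atTop μ).eventually_const_le hq.2).exists

lemma tendsto_real_covStat_lt_sub_cdf {ε ρ : ℕ → ℝ} (hε : ∀ n, ε n ∈ Set.Icc (0 : ℝ) 1)
    (hρ : ∀ n, ρ n ∈ Set.Icc (0 : ℝ) 1)
    (hlim : Tendsto (fun n : ℕ => √n * ε n) atTop (𝓝 0)) (b : ℕ → ℝ) :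
    Tendsto (fun n => (iid n (mixture (ε n) (ρ n))).real {x | covStat n x < b n}
      - cdf stdGauss (b n)) atTop (𝓝 0) := by
  have := fun n => isProbabilityMeasure_mixture (hε n) (ρ n)
  refine tendsto_sub_of_monotone_of_tendsto
    (F := fun n c => (iid n (mixture (ε n) (ρ n))).real {x | covStat n x < c})
    (fun n c d hcd => measureReal_mono fun x hx => lt_of_lt_of_le hx hcd)
    (fun n c => ⟨measureReal_nonneg, measureReal_le_one⟩) (monotone_cdf _)
    (fun c => ⟨cdf_nonneg _ c, cdf_le_one _ c⟩) (Ioo_subset_range_cdf _) (fun c => ?_) b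
  rw [cdf_eq_real, ← measureReal_congr (Iio_ae_eq_Iic (μ := stdGauss) (a := c))]
  exact tendsto_real_covStat_mixture hε hρ hlim measurableSet_Iio (by simp)

lemma measurableSet_le_sum_mul (n : ℕ) (a : ℝ) :
    MeasurableSet {x : Fin n → ℝ × ℝ | a ≤ ∑ i, (x i).1 * (x i).2} :=
  measurableSet_le measurable_const (by fun_prop)

lemma toReal_le_sum_mul {n : ℕ} (hn : 0 < n) (μ : Measure (Fin n → ℝ × ℝ))
    [IsProbabilityMeasure μ] (a : ℝ) :
    (μ {x | a ≤ ∑ i, (x i).1 * (x i).2}).toReal = 1 - μ.real {x | covStat n x < a / √n} := by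
  have hs : (0 : ℝ) < √n := by positivity
  have : {x : Fin n → ℝ × ℝ | covStat n x < a / √n}
      = {x | a ≤ ∑ i, (x i).1 * (x i).2}ᶜ := by
    ext x
    simp [covStat, div_lt_div_iff_of_pos_right hs]
  rw [this, probReal_compl_eq_one_sub (measurableSet_le_sum_mul n a), Measure.real]
  ring

lemma tendsto_sqrt_mul_rpow_neg {β : ℝ} (hβ : 1 / 2 < β) :
    Tendsto (fun n : ℕ => √n * (n : ℝ) ^ (-β)) atTop (𝓝 0) := by
  have h := (tendsto_rpow_neg_atTop (sub_pos.2 hβ)).comp tendsto_natCast_atTop_atTop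
  refine h.congr' ?_
  filter_upwards [eventually_gt_atTop 0] with n hn
  rw [Function.comp_apply, Real.sqrt_eq_rpow, ← Real.rpow_add (by positivity)]
  ring_nf

lemma natCast_rpow_neg_mem_Icc {β : ℝ} (hβ : 0 < β) (n : ℕ) :
    (n : ℝ) ^ (-β) ∈ Set.Icc (0 : ℝ) 1 := by
  refine ⟨by positivity, ?_⟩
  obtain rfl | hn := n.eq_zero_or_pos
  · simp [Real.zero_rpow (neg_ne_zero.2 hβ.ne')]
  · exact Real.rpow_le_one_of_one_le_of_nonpos (by exact_mod_cast hn) (by linarith)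

/-- in the sparse regime (`β > 1/2`), under the alternative `Tₙ/√n`
converges in distribution to the standard normal (stated via convergence of the
distribution functions, the limit `Φ` being continuous), just as under the null;
consequently, for any sequence of thresholds `(aₙ)`, the covariance test rejecting
when `Tₙ ≥ aₙ` has risk with liminf at least 1. -/
theorem covariance_test_sparse_powerless (β : ℝ) (hβ0 : 1 / 2 < β) (hβ1 : β < 1)
    (ε ρ : ℕ → ℝ) (hε : ∀ n : ℕ, ε n = (n : ℝ) ^ (-β))
    (hρ : ∀ n : ℕ, ρ n ∈ Set.Icc (0 : ℝ) 1) :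
    (∀ t : ℝ, Tendsto (fun n =>
        ((iid n (mixture (ε n) (ρ n)))
          {x : Fin n → ℝ × ℝ | (∑ i, (x i).1 * (x i).2) / Real.sqrt n ≤ t}).toReal)
        atTop (𝓝 (Phi t)))
    ∧ (∀ t : ℝ, Tendsto (fun n =>
        ((iid n (biNormal 0))
          {x : Fin n → ℝ × ℝ | (∑ i, (x i).1 * (x i).2) / Real.sqrt n ≤ t}).toReal)
        atTop (𝓝 (Phi t)))
    ∧ ∀ a : ℕ → ℝ,
        1 ≤ Filter.liminf (fun n =>
          ((iid n (biNormal 0))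
              {x : Fin n → ℝ × ℝ | a n ≤ ∑ i, (x i).1 * (x i).2}).toReal
            + (1 - ((iid n (mixture (ε n) (ρ n)))
              {x : Fin n → ℝ × ℝ | a n ≤ ∑ i, (x i).1 * (x i).2}).toReal)) atTop := by
  have hε01 (n : ℕ) : ε n ∈ Set.Icc (0 : ℝ) 1 :=
    hε n ▸ natCast_rpow_neg_mem_Icc (by linarith) n
  have hεlim : Tendsto (fun n : ℕ => √n * ε n) atTop (𝓝 0) := by
    simpa only [hε] using tendsto_sqrt_mul_rpow_neg hβ0
  have h01 (_ : ℕ) : (0 : ℝ) ∈ Set.Icc (0 : ℝ) 1 := ⟨le_rfl, zero_le_one⟩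
  have h0lim : Tendsto (fun n : ℕ => √n * (0 : ℝ)) atTop (𝓝 0) := by simp
  refine ⟨fun t => ?_, fun t => ?_, fun a => ?_⟩
  · exact tendsto_real_covStat_mixture hε01 hρ hεlim (s := Set.Iic t) measurableSet_Iic (by simp)
  · have h := tendsto_real_covStat_mixture h01 h01 h0lim (s := Set.Iic t) measurableSet_Iic
      (by simp)
    simp_rw [mixture_zero] at h
    exact h
  · have hnull := tendsto_real_covStat_lt_sub_cdf h01 h01 h0lim fun n => a n / √n
    simp_rw [mixture_zero] at hnull
    have hdiff :=
      ((tendsto_real_covStat_lt_sub_cdf hε01 hρ hεlim fun n => a n / √n).sub hnull).const_add 1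
    rw [sub_zero, add_zero] at hdiff
    refine (hdiff.congr' ?_).liminf_eq.ge
    filter_upwards [eventually_gt_atTop 0] with n hn
    have := isProbabilityMeasure_mixture (hε01 n) (ρ n)
    rw [toReal_le_sum_mul hn, toReal_le_sum_mul hn]
    ring
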